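/- Let X be σ-compact (a countable union of compact sets), let κ be a perfect kernel on X satisfying Frostman's maximum principle and the domination principle, let A ⊆ X satisfy cap_*(A) > 0 and E⁺(A) closed in (E⁺, d), let f := −U^ζ where ζ ∈ E⁺ and ζ(X) ≤ 1, and assume either cap_*(A) < ∞ or ζ^A(X) = 1, so that the solution λ_{A,f} exists. Set η_{A,f} := (1 − ζ^A(X))/cap_*(A) and Λ_{A,f} := { μ ∈ E⁺ : U_f^μ ≥ η_{A,f} n.e. on A }. Then λ_{A,f} is a measure of minimum total mass in Λ_{A,f}: λ_{A,f}(X) = min{ μ(X) : μ ∈ Λ_{A,f} } = 1. -/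

import Mathlib

open MeasureTheory Topology Filter Set ENNReal

noncomputable section

namespace GaussVar

variable {X : Type*} [TopologicalSpace X] [MeasurableSpace X]

/-- A (positive) Radon measure: a regular Borel measure. -/
def IsRadon (μ : Measure X) : Prop := μ.Regular

/-- The mutual energy `I(μ,ν) = ∬ κ(x,y) d(μ⊗ν)(x,y)`. -/
def mutualEnergy (κ : X → X → ℝ≥0∞) (μ ν : Measure X) : ℝ≥0∞ :=
  ∫⁻ p : X × X, κ p.1 p.2 ∂(μ.prod ν)

/-- The energy `I(μ) := I(μ,μ)`. -/
def energy (κ : X → X → ℝ≥0∞) (μ : Measure X) : ℝ≥0∞ := mutualEnergy κ μ μ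

/-- Membership in the cone `E⁺` of Radon measures with finite energy. -/
def memEplus (κ : X → X → ℝ≥0∞) (μ : Measure X) : Prop :=
  IsRadon μ ∧ energy κ μ < ⊤

/-- A kernel: symmetric and lower semicontinuous with values in `[0,∞]`. -/
def IsKernel (κ : X → X → ℝ≥0∞) : Prop :=
  (∀ x y, κ x y = κ y x) ∧ LowerSemicontinuous (fun p : X × X => κ p.1 p.2)

/-- The strong (energy) metric `d(μ,ν) := (I(μ)+I(ν)−2I(μ,ν))^{1/2}` on `E⁺`. -/
def strongDist (κ : X → X → ℝ≥0∞) (μ ν : Measure X) : ℝ :=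
  Real.sqrt ((energy κ μ).toReal + (energy κ ν).toReal - 2 * (mutualEnergy κ μ ν).toReal)

/-- The energy principle (strict positive definiteness). -/
def EnergyPrinciple (κ : X → X → ℝ≥0∞) : Prop :=
  ∀ μ ν : Measure X, memEplus κ μ → memEplus κ ν →
    2 * mutualEnergy κ μ ν ≤ energy κ μ + energy κ ν ∧
      (2 * mutualEnergy κ μ ν = energy κ μ + energy κ ν → μ = ν)

/-- Convergence of a sequence in the strong metric. -/
def StrongTendstoSeq (κ : X → X → ℝ≥0∞) (μ : ℕ → Measure X) (μ₀ : Measure X) : Prop :=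
  Tendsto (fun n => strongDist κ (μ n) μ₀) atTop (𝓝 0)

/-- Vague convergence of a sequence of measures. -/
def VagueTendstoSeq (μ : ℕ → Measure X) (μ₀ : Measure X) : Prop :=
  ∀ φ : X → ℝ, Continuous φ → HasCompactSupport φ →
    Tendsto (fun n => ∫ x, φ x ∂(μ n)) atTop (𝓝 (∫ x, φ x ∂μ₀))

/-- Cauchy sequence in the strong metric. -/
def StrongCauchySeq (κ : X → X → ℝ≥0∞) (μ : ℕ → Measure X) : Prop :=
  ∀ ε : ℝ, 0 < ε → ∃ N : ℕ, ∀ m ≥ N, ∀ n ≥ N, strongDist κ (μ m) (μ n) < ε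

/-- A perfect kernel: satisfies the energy principle, `(E⁺,d)` is complete, and
strong convergence implies vague convergence. -/
def IsPerfect (κ : X → X → ℝ≥0∞) : Prop :=
  EnergyPrinciple κ ∧
    (∀ μ : ℕ → Measure X, (∀ n, memEplus κ (μ n)) → StrongCauchySeq κ μ →
        ∃ μ₀ : Measure X, memEplus κ μ₀ ∧ StrongTendstoSeq κ μ μ₀) ∧
    (∀ (μ : ℕ → Measure X) (μ₀ : Measure X), (∀ n, memEplus κ (μ n)) → memEplus κ μ₀ →
        StrongTendstoSeq κ μ μ₀ → VagueTendstoSeq μ μ₀)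

/-- `μ` is concentrated on `A`: the complement of `A` is locally `μ`-negligible. -/
def Concentrated (μ : Measure X) (A : Set X) : Prop :=
  ∀ K : Set X, IsCompact K → μ (Aᶜ ∩ K) = 0

/-- Membership in `Ĕ⁺(A)`: finite-energy Radon measures concentrated on `A`
of unit total mass. -/
def memBreve (κ : X → X → ℝ≥0∞) (A : Set X) (μ : Measure X) : Prop :=
  memEplus κ μ ∧ Concentrated μ A ∧ μ Set.univ = 1

/-- `w(A) := inf { I(μ) : μ ∈ Ĕ⁺(A) }` (with `inf ∅ = ⊤`). -/
def wcap (κ : X → X → ℝ≥0∞) (A : Set X) : ℝ≥0∞ :=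
  ⨅ (μ : Measure X) (_ : memBreve κ A μ), energy κ μ

/-- The inner capacity `cap_*(A) := 1 / w(A)`. -/
def innerCap (κ : X → X → ℝ≥0∞) (A : Set X) : ℝ≥0∞ := (wcap κ A)⁻¹

/-- The outer capacity `cap^*(E) := inf { cap_*(D) : D open, E ⊆ D }`. -/
def outerCap (κ : X → X → ℝ≥0∞) (E : Set X) : ℝ≥0∞ :=
  ⨅ (D : Set X) (_ : IsOpen D ∧ E ⊆ D), innerCap κ D

/-- `P` holds nearly everywhere (n.e.) on `A`: the exceptional subset of `A`
has inner capacity zero. -/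
def NearlyEverywhere (κ : X → X → ℝ≥0∞) (A : Set X) (P : X → Prop) : Prop :=
  innerCap κ {x ∈ A | ¬ P x} = 0

/-- The potential `U^μ(x) := ∫ κ(x,y) dμ(y)`. -/
def potential (κ : X → X → ℝ≥0∞) (μ : Measure X) (x : X) : ℝ≥0∞ :=
  ∫⁻ y, κ x y ∂μ

/-- An external field: `f = ψ + U^{ϑ⁺} − U^{ϑ⁻}` where `ψ` is lower semicontinuous,
`(−∞,∞]`-valued, positive if `X` is noncompact, and `ϑ⁺, ϑ⁻ ∈ E⁺`. -/
def IsExternalField (κ : X → X → ℝ≥0∞) (f : X → EReal) : Prop :=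
  ∃ (ψ : X → EReal) (ϑp ϑm : Measure X),
    LowerSemicontinuous ψ ∧ (∀ x, ψ x ≠ ⊥) ∧ (¬ CompactSpace X → ∀ x, 0 ≤ ψ x) ∧
    memEplus κ ϑp ∧ memEplus κ ϑm ∧
    ∀ x, f x = ψ x + (potential κ ϑp x : EReal) - (potential κ ϑm x : EReal)

/-- `f` is `μ`-integrable (as an extended-real-valued function). -/
def FieldIntegrable (f : X → EReal) (μ : Measure X) : Prop :=
  Integrable (fun x => (f x).toReal) μ ∧ (∀ᵐ x ∂μ, f x ≠ ⊤ ∧ f x ≠ ⊥)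

/-- `∫ f dμ` for an a.e.-finite integrable field. -/
def fieldIntegral (f : X → EReal) (μ : Measure X) : ℝ := ∫ x, (f x).toReal ∂μ

/-- The Gauss functional `I_f(μ) := I(μ) + 2 ∫ f dμ`. -/
def gaussI (κ : X → X → ℝ≥0∞) (f : X → EReal) (μ : Measure X) : ℝ :=
  (energy κ μ).toReal + 2 * fieldIntegral f μ

/-- Membership in `Ĕ⁺_f(A)`. -/
def Admissible (κ : X → X → ℝ≥0∞) (A : Set X) (f : X → EReal) (μ : Measure X) : Prop :=
  memBreve κ A μ ∧ FieldIntegrable f μ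

/-- `w_f(A) := inf { I_f(μ) : μ ∈ Ĕ⁺_f(A) }` (with `inf ∅ = ⊤`). -/
def wf (κ : X → X → ℝ≥0∞) (A : Set X) (f : X → EReal) : EReal :=
  ⨅ (μ : Measure X) (_ : Admissible κ A f μ), ((gaussI κ f μ : ℝ) : EReal)

/-- `l` is a solution of the inner Gauss variational problem for `(A,f)`. -/
def IsSolution (κ : X → X → ℝ≥0∞) (A : Set X) (f : X → EReal) (l : Measure X) : Prop :=
  Admissible κ A f l ∧ ((gaussI κ f l : ℝ) : EReal) = wf κ A f

/-- The `f`-weighted potential `U_f^μ := U^μ + f`. -/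
def wPotential (κ : X → X → ℝ≥0∞) (f : X → EReal) (μ : Measure X) (x : X) : EReal :=
  (potential κ μ x : EReal) + f x

/-- `∫ U_f^μ dμ`, the weighted equilibrium constant of a solution. -/
def wConst (κ : X → X → ℝ≥0∞) (f : X → EReal) (μ : Measure X) : ℝ :=
  ∫ x, (wPotential κ f μ x).toReal ∂μ

/-- The cone `E⁺(A)` is closed in the strong metric. -/
def StrongClosedEplusOn (κ : X → X → ℝ≥0∞) (A : Set X) : Prop :=
  ∀ (μ : ℕ → Measure X) (μ₀ : Measure X),
    (∀ n, memEplus κ (μ n) ∧ Concentrated (μ n) A) →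
    memEplus κ μ₀ → StrongTendstoSeq κ μ μ₀ → Concentrated μ₀ A

/-- Frostman's (first) maximum principle. -/
def FrostmanMax (κ : X → X → ℝ≥0∞) : Prop :=
  ∀ μ : Measure X, memEplus κ μ →
    (∀ x : X, (∀ U : Set X, IsOpen U → x ∈ U → 0 < μ U) → potential κ μ x ≤ 1) →
    ∀ x : X, potential κ μ x ≤ 1

/-- The domination (second maximum) principle. -/
def DominationPrinciple (κ : X → X → ℝ≥0∞) : Prop :=
  ∀ μ ν : Measure X, memEplus κ μ → memEplus κ ν →
    (∀ᵐ x ∂μ, potential κ μ x ≤ potential κ ν x) →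
    ∀ x : X, potential κ μ x ≤ potential κ ν x

/-- `β` is the inner balayage of `ζ` onto `A`: `β ∈ E⁺(A)` and `U^β = U^ζ` n.e. on `A`. -/
def IsInnerBalayage (κ : X → X → ℝ≥0∞) (A : Set X) (ζ β : Measure X) : Prop :=
  memEplus κ β ∧ Concentrated β A ∧
    NearlyEverywhere κ A (fun x => potential κ β x = potential κ ζ x)

/-- `γ` is the inner capacitary measure of `A`: `γ ∈ E⁺(A)` and `U^γ = 1` n.e. on `A`. -/
def IsCapacitaryMeasure (κ : X → X → ℝ≥0∞) (A : Set X) (γ : Measure X) : Prop :=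
  memEplus κ γ ∧ Concentrated γ A ∧
    NearlyEverywhere κ A (fun x => potential κ γ x = 1)

/-- `A` is quasiclosed: approximable in outer capacity by closed sets. -/
def Quasiclosed (κ : X → X → ℝ≥0∞) (A : Set X) : Prop :=
  ∀ ε : ℝ≥0∞, 0 < ε → ∃ F : Set X, IsClosed F ∧ outerCap κ (symmDiff A F) < ε

/-- `A` is quasicompact: approximable in outer capacity by compact sets. -/
def Quasicompact (κ : X → X → ℝ≥0∞) (A : Set X) : Prop :=
  ∀ ε : ℝ≥0∞, 0 < ε → ∃ K : Set X, IsCompact K ∧ outerCap κ (symmDiff A K) < ε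

section DirectedSup

variable {X : Type*} [TopologicalSpace X] [T2Space X]
    [SigmaCompactSpace X] [MeasurableSpace X] [BorelSpace X]

/-- Any union of open sets agrees, up to a null set of a Radon measure, with a countable
subunion. -/
lemma exists_countable_iUnion_open_ae {ι : Type*} (μ : Measure X) [μ.Regular]
    (U : ι → Set X) (hU : ∀ i, IsOpen (U i)) :
    ∃ C : Set ι, C.Countable ∧ μ ((⋃ i, U i) \ ⋃ i ∈ C, U i) = 0 := by
  have hO : IsOpen (⋃ i, U i) := isOpen_iUnion hU
  have key : ∀ n m : ℕ, ∃ t : Finset ι,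
      μ ((compactCovering X n ∩ ⋃ i, U i) \ ⋃ i ∈ t, U i) ≤ ((m : ℝ≥0∞) + 1)⁻¹ := by
    intro n m
    have hfin : μ (compactCovering X n ∩ ⋃ i, U i) ≠ ⊤ :=
      ((measure_mono inter_subset_left).trans_lt (isCompact_compactCovering X n).measure_lt_top).ne
    obtain ⟨K, hKs, hK, hlt⟩ := ((isCompact_compactCovering X n).measurableSet.inter
      hO.measurableSet).exists_isCompact_sdiff_lt (μ := μ) hfin
      (ε := ((m : ℝ≥0∞) + 1)⁻¹) (by simp)
    obtain ⟨t, ht⟩ := hK.elim_finite_subcover U hU (hKs.trans inter_subset_right)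
    exact ⟨t, (measure_mono (sdiff_subset_sdiff_right ht)).trans hlt.le⟩
  choose t ht using key
  refine ⟨⋃ n, ⋃ m, (t n m : Set ι),
    countable_iUnion fun n => countable_iUnion fun m => (t n m).countable_toSet, ?_⟩
  have hsub : (⋃ i, U i) \ ⋃ i ∈ ⋃ n, ⋃ m, (t n m : Set ι), U i ⊆
      ⋃ n, ((compactCovering X n ∩ ⋃ i, U i) \ ⋃ i ∈ ⋃ n, ⋃ m, (t n m : Set ι), U i) := by
    intro x hx
    obtain ⟨n, hn⟩ := mem_iUnion.1 ((iUnion_compactCovering X).symm ▸ mem_univ x)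
    exact mem_iUnion.2 ⟨n, ⟨hn, hx.1⟩, hx.2⟩
  refine measure_mono_null hsub (measure_iUnion_null fun n => ?_)
  refine le_antisymm (ENNReal.le_of_forall_pos_le_add fun ε hε _ => ?_) zero_le
  obtain ⟨m, hm⟩ := ENNReal.exists_inv_nat_lt (a := (ε : ℝ≥0∞)) (by simpa using hε.ne')
  refine (measure_mono (sdiff_subset_sdiff_right ?_)).trans ((ht n m).trans ?_)
  · intro x hx
    simp only [mem_iUnion] at hx ⊢
    obtain ⟨i, hi, hxi⟩ := hx
    exact ⟨i, ⟨n, m, hi⟩, hxi⟩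
  · rw [zero_add]
    exact (ENNReal.inv_le_inv.2 le_self_add).trans hm.le

/-- Integration against a Radon measure commutes with directed suprema of lower semicontinuous
functions. -/
lemma lintegral_iSup_directed_lsc {ι : Type*} [Nonempty ι] (μ : Measure X) [μ.Regular]
    (f : ι → X → ℝ≥0∞) (hf : ∀ i, LowerSemicontinuous (f i)) (hd : Directed (· ≤ ·) f) :
    ∫⁻ x, ⨆ i, f i x ∂μ = ⨆ i, ∫⁻ x, f i x ∂μ := by
  refine le_antisymm ?_ (iSup_lintegral_le _)
  choose C hC hC0 using fun q : ℚ => exists_countable_iUnion_open_ae μ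
    (fun i => {x | ((q : ℝ).toNNReal : ℝ≥0∞) < f i x}) fun i => (hf i).isOpen_preimage _
  have hcount : (⋃ q, C q).Countable := countable_iUnion hC
  have : Countable (⋃ q, C q : Set ι) := hcount
  have hae : ∀ᵐ x ∂μ, ⨆ i, f i x ≤ ⨆ s : Finset (⋃ q, C q : Set ι), s.sup fun i => f i x := by
    have h0 := ae_all_iff.2 fun q => measure_eq_zero_iff_ae_notMem.1 (hC0 q)
    filter_upwards [h0] with x hx
    by_contra! hlt
    obtain ⟨q, -, hq1, hq2⟩ := ENNReal.lt_iff_exists_rat_btwn.1 hlt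
    have hxq := hx q
    obtain ⟨i, hi, hqi⟩ : ∃ i ∈ C q, ((q : ℝ).toNNReal : ℝ≥0∞) < f i x := by
      by_contra hcon
      refine hxq ⟨mem_iUnion.2 (lt_iSup_iff.1 hq2), fun hmem => hcon ?_⟩
      obtain ⟨i, hi, h⟩ := mem_iUnion₂.1 hmem
      exact ⟨i, hi, h⟩
    have hle : f i x ≤ ⨆ s : Finset (⋃ q, C q : Set ι), s.sup fun i => f i x := by
      refine le_trans ?_ (le_iSup _ {(⟨i, mem_iUnion.2 ⟨q, hi⟩⟩ : (⋃ q, C q : Set ι))})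
      simp
    exact absurd (hqi.trans_le hle) hq1.not_gt
  refine (lintegral_mono_ae hae).trans ?_
  rw [lintegral_iSup_directed]
  · refine iSup_le fun s => ?_
    obtain ⟨z, hz⟩ := hd.finset_le (s.map (Function.Embedding.subtype _))
    refine (lintegral_mono fun x => Finset.sup_le fun i hi => ?_).trans (le_iSup (fun i => ∫⁻ x, f i x ∂μ) z)
    exact hz i (Finset.mem_map_of_mem (Function.Embedding.subtype _) hi) x
  · intro s
    simp only [Finset.sup_eq_iSup]
    exact (Measurable.biSup _ s.countable_toSet fun i _ => (hf i).measurable).aemeasurable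
  · classical
    exact directed_of_isDirected_le fun s t hst x => Finset.sup_mono hst

end DirectedSup

section Tonelli

/-- The function equal to `c` on `U ×ˢ V` and to `0` elsewhere, for `b = (c, U, V)`. -/
def boxFun {X : Type*} (b : ℝ≥0∞ × Set X × Set X) (x y : X) : ℝ≥0∞ :=
  (b.2.1 ×ˢ b.2.2).indicator (fun _ => b.1) (x, y)

/-- The boxes `(c, U, V)` with `U`, `V` open whose box function is below `κ`. -/
def Box {X : Type*} [TopologicalSpace X] (κ : X → X → ℝ≥0∞) : Type _ :=
  {b : ℝ≥0∞ × Set X × Set X //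
    IsOpen b.2.1 ∧ IsOpen b.2.2 ∧ ∀ x ∈ b.2.1, ∀ y ∈ b.2.2, b.1 ≤ κ x y}

/-- The supremum of the box functions of a finite set of boxes. -/
def boxSup {X : Type*} [TopologicalSpace X] (κ : X → X → ℝ≥0∞) (s : Finset (Box κ))
    (x y : X) : ℝ≥0∞ :=
  s.sup fun b => boxFun b.1 x y

lemma boxFun_eq {X : Type*} (b : ℝ≥0∞ × Set X × Set X) (x y : X) :
    boxFun b x y = b.2.2.indicator (fun _ => b.2.1.indicator (fun _ => b.1) x) y := by
  by_cases hx : x ∈ b.2.1 <;> by_cases hy : y ∈ b.2.2 <;> simp [boxFun, hx, hy]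

lemma mutualEnergy_comm {X : Type*} [TopologicalSpace X] [MeasurableSpace X]
    {κ : X → X → ℝ≥0∞} (hκ : IsKernel κ) (μ ν : Measure X) [SFinite μ] [SFinite ν] :
    mutualEnergy κ μ ν = mutualEnergy κ ν μ := by
  rw [mutualEnergy, ← Measure.prod_swap]
  exact (lintegral_map_equiv _ MeasurableEquiv.prodComm).trans
    (lintegral_congr fun p => hκ.1 _ _)

variable {X : Type*} [TopologicalSpace X] {κ : X → X → ℝ≥0∞}

lemma boxSup_mono {s t : Finset (Box κ)} (h : s ⊆ t) (x y : X) :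
    boxSup κ s x y ≤ boxSup κ t x y := Finset.sup_mono h

lemma iSup_boxSup (hκ : LowerSemicontinuous fun p : X × X => κ p.1 p.2) (x y : X) :
    ⨆ s, boxSup κ s x y = κ x y := by
  refine le_antisymm (iSup_le fun s => Finset.sup_le fun b _ => ?_) (le_of_forall_lt fun c hc => ?_)
  · by_cases h : (x, y) ∈ b.1.2.1 ×ˢ b.1.2.2
    · simpa [boxFun, h] using b.2.2.2 x h.1 y h.2
    · simp [boxFun, h]
  · obtain ⟨d, hcd, hd⟩ := exists_between hc
    have hev : ∀ᶠ p in 𝓝 (x, y), d < κ p.1 p.2 := hκ (x, y) d hd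
    obtain ⟨U, V, hU, hxU, hV, hyV, hUV⟩ := mem_nhds_prod_iff'.1 hev
    let b : Box κ := ⟨(d, U, V), hU, hV, fun a ha b hb => le_of_lt (hUV (mk_mem_prod ha hb))⟩
    refine hcd.trans_le (le_trans ?_ (le_iSup _ {b}))
    have hd : d ≤ boxFun b.1 x y := by simp [boxFun, b, hxU, hyV]
    exact hd.trans (Finset.le_sup (f := fun b : Box κ => boxFun b.1 x y)
      (Finset.mem_singleton_self b))

lemma boxSup_lsc_right (s : Finset (Box κ)) (x : X) :
    LowerSemicontinuous (boxSup κ s x) := by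
  have : LowerSemicontinuous fun y => ⨆ b ∈ s,
      b.1.2.2.indicator (fun _ => b.1.2.1.indicator (fun _ => b.1.1) x) y :=
    lowerSemicontinuous_iSup fun b => lowerSemicontinuous_iSup fun _ =>
      b.2.2.1.lowerSemicontinuous_indicator zero_le
  convert this using 2
  simp [boxSup, Finset.sup_eq_iSup, boxFun_eq]

lemma measurable_boxSup [MeasurableSpace X] [OpensMeasurableSpace X] (s : Finset (Box κ)) :
    Measurable fun p : X × X => boxSup κ s p.1 p.2 := by
  simp only [boxSup, Finset.sup_eq_iSup]
  refine Measurable.biSup _ s.countable_toSet fun b _ => ?_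
  exact measurable_const.indicator (b.2.1.measurableSet.prod b.2.2.1.measurableSet)

lemma lintegral_boxSup_lsc [MeasurableSpace X] (ν : Measure X) (s : Finset (Box κ)) :
    LowerSemicontinuous fun x => ∫⁻ y, boxSup κ s x y ∂ν := by
  intro x₀ z hz
  have : ∀ᶠ x in 𝓝 x₀, ∀ b ∈ s, x₀ ∈ b.1.2.1 → x ∈ b.1.2.1 := by
    rw [Finset.eventually_all]
    intro b _
    by_cases h : x₀ ∈ b.1.2.1
    · filter_upwards [b.2.1.mem_nhds h] with x hx _ using hx
    · simp [h]
  filter_upwards [this] with x hx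
  refine hz.trans_le (lintegral_mono fun y => Finset.sup_mono_fun fun b hb => ?_)
  by_cases h : x₀ ∈ b.1.2.1
  · simp [boxFun_eq, h, hx b hb h]
  · simp [boxFun_eq, h]

variable [T2Space X] [SigmaCompactSpace X] [MeasurableSpace X]
  [BorelSpace X]

lemma potential_eq_iSup (hκ : IsKernel κ) (ν : Measure X) [ν.Regular] (x : X) :
    potential κ ν x = ⨆ s, ∫⁻ y, boxSup κ s x y ∂ν := by
  classical
  rw [← lintegral_iSup_directed_lsc ν (fun s => boxSup κ s x) (fun s => boxSup_lsc_right s x)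
    (directed_of_isDirected_le fun s t hst y => boxSup_mono hst x y)]
  simp only [iSup_boxSup hκ.2, potential]

lemma potential_lsc (hκ : IsKernel κ) (ν : Measure X) [ν.Regular] :
    LowerSemicontinuous (potential κ ν) := by
  have : potential κ ν = fun x => ⨆ s, ∫⁻ y, boxSup κ s x y ∂ν :=
    funext (potential_eq_iSup hκ ν)
  rw [this]
  exact lowerSemicontinuous_iSup fun s => lintegral_boxSup_lsc ν s

lemma measurable_potential (hκ : IsKernel κ) (ν : Measure X) [ν.Regular] :
    Measurable (potential κ ν) := (potential_lsc hκ ν).measurable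

/-- Tonelli's theorem for lower semicontinuous kernels and Radon measures. -/
lemma mutualEnergy_eq_lintegral_potential (hκ : IsKernel κ) (μ ν : Measure X) [μ.Regular]
    [ν.Regular] : mutualEnergy κ μ ν = ∫⁻ x, potential κ ν x ∂μ := by
  classical
  refine le_antisymm ?_ ?_
  · obtain ⟨g, hg, hgκ, heq⟩ := exists_measurable_le_lintegral_eq (μ.prod ν)
      fun p : X × X => κ p.1 p.2
    rw [mutualEnergy, heq, lintegral_prod _ hg.aemeasurable]
    exact lintegral_mono fun x => lintegral_mono fun y => hgκ (x, y)
  · simp_rw [potential_eq_iSup hκ ν]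
    rw [lintegral_iSup_directed_lsc μ _ (lintegral_boxSup_lsc ν)
      (directed_of_isDirected_le fun s t hst x => lintegral_mono fun y => boxSup_mono hst x y)]
    refine iSup_le fun s => ?_
    rw [← lintegral_prod _ (measurable_boxSup s).aemeasurable]
    exact lintegral_mono fun p => (le_iSup (fun s => boxSup κ s p.1 p.2) s).trans_eq
      (iSup_boxSup hκ.2 p.1 p.2)

end Tonelli

section EnergyAlgebra

lemma memEplus.regular {X : Type*} [TopologicalSpace X] [MeasurableSpace X]
    {κ : X → X → ℝ≥0∞} {μ : Measure X} (h : memEplus κ μ) : μ.Regular := h.1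

/-- The mutual energy as a real number. -/
def realEnergy {X : Type*} [MeasurableSpace X] (κ : X → X → ℝ≥0∞) (μ ν : Measure X) : ℝ :=
  (mutualEnergy κ μ ν).toReal

lemma realEnergy_nonneg {X : Type*} [MeasurableSpace X] (κ : X → X → ℝ≥0∞)
    (μ ν : Measure X) : 0 ≤ realEnergy κ μ ν := ENNReal.toReal_nonneg

lemma Concentrated.mono {X : Type*} [TopologicalSpace X] [MeasurableSpace X] {μ : Measure X}
    {A B : Set X} (h : Concentrated μ A) (hAB : A ⊆ B) : Concentrated μ B := fun K hK =>
  measure_mono_null (inter_subset_inter_left _ (compl_subset_compl.2 hAB)) (h K hK)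

lemma memBreve.mono {X : Type*} [TopologicalSpace X] [MeasurableSpace X] {κ : X → X → ℝ≥0∞}
    {μ : Measure X} {A B : Set X} (h : memBreve κ A μ) (hAB : A ⊆ B) : memBreve κ B μ :=
  ⟨h.1, h.2.1.mono hAB, h.2.2⟩

lemma wcap_le_energy {X : Type*} [TopologicalSpace X] [MeasurableSpace X]
    {κ : X → X → ℝ≥0∞} {μ : Measure X} {A : Set X} (h : memBreve κ A μ) :
    wcap κ A ≤ energy κ μ := iInf₂_le μ h

lemma memBreve.wcap_ne_top {X : Type*} [TopologicalSpace X] [MeasurableSpace X]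
    {κ : X → X → ℝ≥0∞} {μ : Measure X} {A : Set X} (h : memBreve κ A μ) : wcap κ A ≠ ⊤ :=
  ((wcap_le_energy h).trans_lt h.1.2).ne

lemma Concentrated.ae_mem {X : Type*} [TopologicalSpace X] [SigmaCompactSpace X]
    [MeasurableSpace X] {μ : Measure X} {A : Set X} (h : Concentrated μ A) :
    ∀ᵐ x ∂μ, x ∈ A := by
  change μ Aᶜ = 0
  have : Aᶜ ⊆ ⋃ n, Aᶜ ∩ compactCovering X n := by
    rw [← inter_iUnion, iUnion_compactCovering, inter_univ]
  exact measure_mono_null this (measure_iUnion_null fun n => h _ (isCompact_compactCovering X n))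

lemma Concentrated.add {X : Type*} [TopologicalSpace X] [MeasurableSpace X]
    {μ ν : Measure X} {A : Set X} (hμ : Concentrated μ A) (hν : Concentrated ν A) :
    Concentrated (μ + ν) A := fun K hK => by simp [hμ K hK, hν K hK]

lemma Concentrated.smul {X : Type*} [TopologicalSpace X] [MeasurableSpace X]
    {μ : Measure X} {A : Set X} (hμ : Concentrated μ A) (c : ℝ≥0∞) :
    Concentrated (c • μ) A := fun K hK => by simp [hμ K hK]

lemma mutualEnergy_ne_top {X : Type*} [TopologicalSpace X] [MeasurableSpace X]
    {κ : X → X → ℝ≥0∞} (hE : EnergyPrinciple κ) {μ ν : Measure X} (hμ : memEplus κ μ)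
    (hν : memEplus κ ν) : mutualEnergy κ μ ν ≠ ⊤ := by
  have h := ((hE μ ν hμ hν).1.trans_lt (ENNReal.add_lt_top.2 ⟨hμ.2, hν.2⟩)).ne
  exact fun h' => h (by simp [h'])

lemma two_mul_realEnergy_le {X : Type*} [TopologicalSpace X] [MeasurableSpace X]
    {κ : X → X → ℝ≥0∞} (hE : EnergyPrinciple κ) {μ ν : Measure X} (hμ : memEplus κ μ)
    (hν : memEplus κ ν) :
    2 * realEnergy κ μ ν ≤ realEnergy κ μ μ + realEnergy κ ν ν := by
  have h := ENNReal.toReal_mono (ENNReal.add_lt_top.2 ⟨hμ.2, hν.2⟩).ne (hE μ ν hμ hν).1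
  rw [ENNReal.toReal_add hμ.2.ne hν.2.ne, ENNReal.toReal_mul] at h
  simpa [realEnergy, energy] using h

lemma eq_of_realEnergy_le {X : Type*} [TopologicalSpace X] [MeasurableSpace X]
    {κ : X → X → ℝ≥0∞} (hE : EnergyPrinciple κ) {μ ν : Measure X} (hμ : memEplus κ μ)
    (hν : memEplus κ ν)
    (h : realEnergy κ μ μ + realEnergy κ ν ν ≤ 2 * realEnergy κ μ ν) : μ = ν := by
  refine (hE μ ν hμ hν).2 ?_
  have h' := le_antisymm (two_mul_realEnergy_le hE hμ hν) h
  rw [← ENNReal.toReal_eq_toReal_iff' (ENNReal.mul_ne_top (by simp) (mutualEnergy_ne_top hE hμ hν))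
    (ENNReal.add_lt_top.2 ⟨hμ.2, hν.2⟩).ne, ENNReal.toReal_add hμ.2.ne hν.2.ne,
    ENNReal.toReal_mul]
  simpa [realEnergy, energy] using h'

lemma memBreve.ne_zero {X : Type*} [TopologicalSpace X] [MeasurableSpace X]
    {κ : X → X → ℝ≥0∞} {μ : Measure X} {A : Set X} (h : memBreve κ A μ) : μ ≠ 0 := by
  rintro rfl
  simpa using h.2.2

lemma realEnergy_pos {X : Type*} [TopologicalSpace X] [MeasurableSpace X]
    {κ : X → X → ℝ≥0∞} (hE : EnergyPrinciple κ) {μ : Measure X} (hμ : memEplus κ μ)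
    (h0 : μ ≠ 0) : 0 < realEnergy κ μ μ := by
  refine (realEnergy_nonneg κ μ μ).lt_of_ne fun h => h0 ?_
  have hz : memEplus κ (0 : Measure X) :=
    ⟨Measure.Regular.zero, by simp [energy, mutualEnergy]⟩
  exact eq_of_realEnergy_le hE hμ hz (by simp [realEnergy, mutualEnergy] at h ⊢; simp [← h])

lemma exists_memBreve_realEnergy_lt {X : Type*} [TopologicalSpace X] [MeasurableSpace X]
    {κ : X → X → ℝ≥0∞} {A : Set X} (hw : wcap κ A ≠ ⊤) {ε : ℝ} (hε : 0 < ε) :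
    ∃ μ, memBreve κ A μ ∧ realEnergy κ μ μ < (wcap κ A).toReal + ε := by
  have hlt : wcap κ A < ENNReal.ofReal ((wcap κ A).toReal + ε) := by
    rw [← ENNReal.toReal_lt_toReal hw ENNReal.ofReal_ne_top,
      ENNReal.toReal_ofReal (by positivity)]
    linarith
  rw [wcap] at hlt
  simp only [iInf_lt_iff] at hlt
  obtain ⟨μ, hμ, h⟩ := hlt
  refine ⟨μ, hμ, ?_⟩
  have := (ENNReal.toReal_lt_toReal hμ.1.2.ne ENNReal.ofReal_ne_top).2 h
  rwa [ENNReal.toReal_ofReal (by positivity)] at this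

lemma exists_minimizing_seq {X : Type*} [TopologicalSpace X] [MeasurableSpace X]
    {κ : X → X → ℝ≥0∞} {A : Set X} (hw : wcap κ A ≠ ⊤) :
    ∃ μ : ℕ → Measure X, (∀ n, memBreve κ A (μ n)) ∧
      Tendsto (fun n => realEnergy κ (μ n) (μ n)) atTop (𝓝 (wcap κ A).toReal) := by
  choose μ hμ hlt using fun n : ℕ =>
    exists_memBreve_realEnergy_lt (κ := κ) hw (Nat.one_div_pos_of_nat : 0 < 1 / ((n : ℝ) + 1))
  have hlim : Tendsto (fun n : ℕ => (wcap κ A).toReal + 1 / ((n : ℝ) + 1)) atTop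
      (𝓝 ((wcap κ A).toReal + 0)) := tendsto_one_div_add_atTop_nhds_zero_nat.const_add _
  rw [add_zero] at hlim
  refine ⟨μ, hμ, tendsto_of_tendsto_of_tendsto_of_le_of_le tendsto_const_nhds hlim
    (fun n => ?_) fun n => (hlt n).le⟩
  exact ENNReal.toReal_mono (hμ n).1.2.ne (wcap_le_energy (hμ n))

lemma potential_smul {X : Type*} [MeasurableSpace X] {κ : X → X → ℝ≥0∞} (c : ℝ≥0∞) (μ : Measure X) (x : X) :
    potential κ (c • μ) x = c * potential κ μ x := by
  simp [potential]

lemma concentrated_restrict {X : Type*} [TopologicalSpace X] [MeasurableSpace X]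
    {μ : Measure X} {K : Set X} (hK : MeasurableSet K) : Concentrated (μ.restrict K) K :=
  fun C _ => by
    rw [Measure.restrict_apply' hK]
    exact measure_mono_null (fun x hx => absurd hx.2 hx.1.1) measure_empty

lemma realEnergy_comm {X : Type*} [TopologicalSpace X] [SigmaCompactSpace X]
    [MeasurableSpace X] {κ : X → X → ℝ≥0∞} (hκ : IsKernel κ) {μ ν : Measure X} (hμ : memEplus κ μ)
    (hν : memEplus κ ν) : realEnergy κ μ ν = realEnergy κ ν μ := by
  have := hμ.regular
  have := hν.regular
  rw [realEnergy, mutualEnergy_comm hκ, realEnergy]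

variable {X : Type*} [TopologicalSpace X] [T2Space X] [SigmaCompactSpace X] [MeasurableSpace X]
  [BorelSpace X] {κ : X → X → ℝ≥0∞}

lemma regular_add [LocallyCompactSpace X] (μ ν : Measure X) [μ.Regular] [ν.Regular] :
    (μ + ν).Regular := by
  have : IsFiniteMeasureOnCompacts (μ + ν) := ⟨fun K hK => by
    simpa using ⟨hK.measure_lt_top, hK.measure_lt_top⟩⟩
  have : (μ + ν).OuterRegular := by
    refine ⟨fun A hA r hr => ?_⟩
    obtain ⟨ε, hε, hlt⟩ := ENNReal.lt_iff_exists_add_pos_lt.1 hr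
    have hfin : μ A + ν A ≠ ⊤ := by simpa using hr.ne_top
    have hε2 : (ε : ℝ≥0∞) / 2 ≠ 0 := by simpa using hε.ne'
    obtain ⟨U, hAU, hU, hμU⟩ := A.exists_isOpen_lt_add (μ := μ) (by aesop) hε2
    obtain ⟨V, hAV, hV, hνV⟩ := A.exists_isOpen_lt_add (μ := ν) (by aesop) hε2
    refine ⟨U ∩ V, subset_inter hAU hAV, hU.inter hV, lt_of_le_of_lt ?_ hlt⟩
    calc (μ + ν) (U ∩ V) ≤ μ U + ν V := by
          rw [Measure.add_apply]
          exact add_le_add (measure_mono inter_subset_left) (measure_mono inter_subset_right)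
      _ ≤ (μ A + ε / 2) + (ν A + ε / 2) := add_le_add hμU.le hνV.le
      _ = (μ + ν) A + ε := by
          rw [Measure.add_apply, add_add_add_comm, ENNReal.add_halves]
  exact ⟨fun U hU r hr => hU.measurableSet.exists_lt_isCompact hr⟩

lemma mutualEnergy_smul_left (hκ : IsKernel κ) (c : ℝ≥0∞) (hc : c ≠ ⊤) (μ ν : Measure X)
    [μ.Regular] [ν.Regular] : mutualEnergy κ (c • μ) ν = c * mutualEnergy κ μ ν := by
  have := Measure.Regular.smul (μ := μ) hc
  rw [mutualEnergy_eq_lintegral_potential hκ, mutualEnergy_eq_lintegral_potential hκ,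
    lintegral_smul_measure, smul_eq_mul]

lemma mutualEnergy_smul_right (hκ : IsKernel κ) (c : ℝ≥0∞) (hc : c ≠ ⊤) (μ ν : Measure X)
    [μ.Regular] [ν.Regular] : mutualEnergy κ μ (c • ν) = c * mutualEnergy κ μ ν := by
  have := Measure.Regular.smul (μ := ν) hc
  rw [mutualEnergy_comm hκ, mutualEnergy_smul_left hκ c hc, mutualEnergy_comm hκ]

lemma energy_smul (hκ : IsKernel κ) (c : ℝ≥0∞) (hc : c ≠ ⊤) (μ : Measure X) [μ.Regular] :
    energy κ (c • μ) = c * (c * energy κ μ) := by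
  have := Measure.Regular.smul (μ := μ) hc
  rw [energy, mutualEnergy_smul_left hκ c hc, mutualEnergy_smul_right hκ c hc, energy]

lemma memEplus.smul (hκ : IsKernel κ) {c : ℝ≥0∞} (hc : c ≠ ⊤) {μ : Measure X}
    (hμ : memEplus κ μ) : memEplus κ (c • μ) := by
  have := hμ.regular
  refine ⟨Measure.Regular.smul hc, ?_⟩
  rw [energy_smul hκ c hc]
  exact ENNReal.mul_lt_top hc.lt_top (ENNReal.mul_lt_top hc.lt_top hμ.2)

lemma realEnergy_smul_left (hκ : IsKernel κ) (c : ℝ≥0∞) (hc : c ≠ ⊤) {μ ν : Measure X}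
    (hμ : memEplus κ μ) (hν : memEplus κ ν) :
    realEnergy κ (c • μ) ν = c.toReal * realEnergy κ μ ν := by
  have := hμ.regular
  have := hν.regular
  rw [realEnergy, mutualEnergy_smul_left hκ c hc, ENNReal.toReal_mul, realEnergy]

lemma memEplus.restrict {μ : Measure X} (hμ : memEplus κ μ)
    {S : Set X} (hS : μ S ≠ ⊤) : memEplus κ (μ.restrict S) := by
  have := hμ.regular
  refine ⟨Measure.Regular.restrict_of_measure_ne_top hS, lt_of_le_of_lt ?_ hμ.2⟩
  rw [energy, energy, mutualEnergy, mutualEnergy, Measure.prod_restrict]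
  exact setLIntegral_le_lintegral _ _

/-- The normalized restriction of a finite-energy measure to a compact set it charges. -/
lemma memBreve_normalized_restrict (hκ : IsKernel κ) {μ : Measure X} {A K : Set X}
    (hμ : memEplus κ μ) (hA : Concentrated μ A) (hK : IsCompact K) (hμK : μ K ≠ 0) :
    memBreve κ (A ∩ K) ((μ K)⁻¹ • μ.restrict K) := by
  have := hμ.regular
  have hfin : μ K ≠ ⊤ := hK.measure_lt_top.ne
  refine ⟨(hμ.restrict hfin).smul hκ (by simpa using hμK), fun C _ => ?_, ?_⟩
  · rw [Measure.smul_apply, Measure.restrict_apply' hK.measurableSet]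
    have : (A ∩ K)ᶜ ∩ C ∩ K ⊆ Aᶜ ∩ K := fun x hx => ⟨fun hxA => hx.1.1 ⟨hxA, hx.2⟩, hx.2⟩
    simp [measure_mono_null this (hA K hK)]
  · simp [ENNReal.inv_mul_cancel hμK hfin]

/-- For Borel properties, nearly everywhere on `A` means almost everywhere for all
finite-energy measures concentrated on `A`. -/
lemma nearlyEverywhere_iff (hκ : IsKernel κ) {A : Set X} {P : X → Prop}
    (hP : MeasurableSet {x | P x}) :
    NearlyEverywhere κ A P ↔
      ∀ ν, memEplus κ ν → Concentrated ν A → ∀ᵐ x ∂ν, P x := by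
  rw [NearlyEverywhere, innerCap, ENNReal.inv_eq_zero]
  constructor
  · intro h ν hν hA
    by_contra hne
    have := hν.regular
    obtain ⟨K, hKs, hK, hpos⟩ := hP.compl.exists_lt_isCompact (μ := ν)
      (r := 0) (pos_iff_ne_zero.2 fun h0 => hne h0)
    refine ((memBreve_normalized_restrict hκ hν hA hK hpos.ne').mono ?_).wcap_ne_top h
    exact fun x hx => ⟨hx.1, hKs hx.2⟩
  · intro h
    refine iInf₂_eq_top.2 fun ν hν => ?_
    exfalso
    have h1 := hν.2.1.ae_mem
    have h2 := h ν hν.1 (hν.2.1.mono fun x hx => hx.1)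
    have := ae_neBot.2 hν.ne_zero
    obtain ⟨x, hx1, hx2⟩ := (h1.and h2).exists
    exact hx1.2 hx2

/-- Comparing integrals against all unit measures gives almost everywhere comparison. -/
lemma ae_le_of_forall_lintegral_le (hκ : IsKernel κ) {A : Set X} {g h : X → ℝ≥0∞}
    (hg : Measurable g) (hh : Measurable h)
    (H : ∀ ν, memBreve κ A ν → ∫⁻ x, h x ∂ν ≤ ∫⁻ x, g x ∂ν ∧ ∫⁻ x, h x ∂ν ≠ ⊤)
    {ν : Measure X} (hν : memEplus κ ν) (hA : Concentrated ν A) : ∀ᵐ x ∂ν, h x ≤ g x := by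
  by_contra hne
  have := hν.regular
  obtain ⟨K, hKs, hK, hpos⟩ := (measurableSet_le hh hg).compl.exists_lt_isCompact (μ := ν)
    (r := 0) (pos_iff_ne_zero.2 fun h0 => hne h0)
  have hb := memBreve_normalized_restrict hκ hν hA hK hpos.ne'
  obtain ⟨hle, hfin⟩ := H _ (hb.mono inter_subset_left)
  refine (lintegral_strict_mono hb.ne_zero hh.aemeasurable ?_ ?_).not_ge hle
  · refine ne_top_of_le_ne_top hfin (lintegral_mono_ae ?_)
    filter_upwards [hb.2.1.ae_mem] with x hx using le_of_not_ge (hKs hx.2)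
  · filter_upwards [hb.2.1.ae_mem] with x hx using lt_of_not_ge (hKs hx.2)

variable [LocallyCompactSpace X]

lemma mutualEnergy_add_left (hκ : IsKernel κ) (μ σ ν : Measure X) [μ.Regular] [σ.Regular]
    [ν.Regular] : mutualEnergy κ (μ + σ) ν = mutualEnergy κ μ ν + mutualEnergy κ σ ν := by
  have := regular_add μ σ
  simp only [mutualEnergy_eq_lintegral_potential hκ, lintegral_add_measure]

lemma memEplus.add (hκ : IsKernel κ) (hE : EnergyPrinciple κ) {μ ν : Measure X}
    (hμ : memEplus κ μ) (hν : memEplus κ ν) : memEplus κ (μ + ν) := by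
  have := hμ.regular
  have := hν.regular
  have := regular_add μ ν
  refine ⟨regular_add μ ν, ?_⟩
  rw [energy, mutualEnergy_add_left hκ, mutualEnergy_comm hκ μ, mutualEnergy_comm hκ ν,
    mutualEnergy_add_left hκ, mutualEnergy_add_left hκ]
  have h1 := (mutualEnergy_ne_top hE hμ hν).lt_top
  have h2 := (mutualEnergy_ne_top hE hν hμ).lt_top
  simp only [ENNReal.add_lt_top]
  exact ⟨⟨hμ.2, h2⟩, h1, hν.2⟩

lemma realEnergy_add_left (hκ : IsKernel κ) (hE : EnergyPrinciple κ) {μ σ ν : Measure X}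
    (hμ : memEplus κ μ) (hσ : memEplus κ σ) (hν : memEplus κ ν) :
    realEnergy κ (μ + σ) ν = realEnergy κ μ ν + realEnergy κ σ ν := by
  have := hμ.regular
  have := hσ.regular
  have := hν.regular
  rw [realEnergy, mutualEnergy_add_left hκ, ENNReal.toReal_add (mutualEnergy_ne_top hE hμ hν)
    (mutualEnergy_ne_top hE hσ hν), realEnergy, realEnergy]

lemma realEnergy_add_smul_self (hκ : IsKernel κ) (hE : EnergyPrinciple κ) {μ ν : Measure X}
    (hμ : memEplus κ μ) (hν : memEplus κ ν) {t : ℝ≥0∞} (ht : t ≠ ⊤) :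
    realEnergy κ (μ + t • ν) (μ + t • ν) =
      realEnergy κ μ μ + 2 * t.toReal * realEnergy κ μ ν + t.toReal ^ 2 * realEnergy κ ν ν := by
  have htν := hν.smul hκ ht
  have hs := hμ.add hκ hE htν
  rw [realEnergy_add_left hκ hE hμ htν hs, realEnergy_comm hκ hμ hs,
    realEnergy_comm hκ htν hs, realEnergy_add_left hκ hE hμ htν hμ,
    realEnergy_add_left hκ hE hμ htν htν, realEnergy_smul_left hκ t ht hν htν,
    realEnergy_smul_left hκ t ht hν hμ, realEnergy_comm hκ hμ htν, realEnergy_comm hκ hν htν,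
    realEnergy_smul_left hκ t ht hν hμ, realEnergy_smul_left hκ t ht hν hν,
    realEnergy_comm hκ hν hμ]
  ring

/-- The Cauchy–Schwarz inequality for the signed measure `μ - σ` and the measure `ν`. -/
lemma sq_realEnergy_sub_le (hκ : IsKernel κ) (hE : EnergyPrinciple κ) {μ σ ν : Measure X}
    (hμ : memEplus κ μ) (hσ : memEplus κ σ) (hν : memEplus κ ν) :
    (realEnergy κ μ ν - realEnergy κ σ ν) ^ 2 ≤
      (realEnergy κ μ μ + realEnergy κ σ σ - 2 * realEnergy κ μ σ) * realEnergy κ ν ν := by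
  have key : ∀ {μ σ : Measure X}, memEplus κ μ → memEplus κ σ → ∀ t : ℝ, 0 ≤ t →
      0 ≤ realEnergy κ ν ν * (t * t) + 2 * (realEnergy κ μ ν - realEnergy κ σ ν) * t +
        (realEnergy κ μ μ + realEnergy κ σ σ - 2 * realEnergy κ μ σ) := by
    intro μ σ hμ hσ t ht
    have htop : ENNReal.ofReal t ≠ ⊤ := ENNReal.ofReal_ne_top
    have htν := hν.smul hκ htop
    have h := two_mul_realEnergy_le hE (hμ.add hκ hE htν) hσ
    rw [realEnergy_add_smul_self hκ hE hμ hν htop, realEnergy_add_left hκ hE hμ htν hσ,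
      realEnergy_smul_left hκ _ htop hν hσ, ENNReal.toReal_ofReal ht,
      realEnergy_comm hκ hν hσ] at h
    linarith
  have := discrim_le_zero (a := realEnergy κ ν ν)
    (b := 2 * (realEnergy κ μ ν - realEnergy κ σ ν))
    (c := realEnergy κ μ μ + realEnergy κ σ σ - 2 * realEnergy κ μ σ) fun t => by
      rcases le_total 0 t with ht | ht
      · exact key hμ hσ t ht
      · have := key hσ hμ (-t) (by linarith)
        rw [realEnergy_comm hκ hσ hμ] at this
        linarith
  rw [discrim] at this
  linarith

end EnergyAlgebra

section Minimizers

variable {X : Type*} [TopologicalSpace X] [T2Space X] [SigmaCompactSpace X] [MeasurableSpace X]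
  [BorelSpace X] {κ : X → X → ℝ≥0∞}

lemma memBreve_normalize (hκ : IsKernel κ) {m : Measure X} {A : Set X} (hm : memEplus κ m)
    (hA : Concentrated m A) (h0 : m univ ≠ 0) (htop : m univ ≠ ⊤) :
    memBreve κ A ((m univ)⁻¹ • m) :=
  ⟨hm.smul hκ (by simpa using h0), hA.smul _, by simp [ENNReal.inv_mul_cancel h0 htop]⟩

/-- The energy of a measure on `A` dominates `w(A)` times its squared mass. -/
lemma wcap_mul_sq_le (hκ : IsKernel κ) {m : Measure X} {A : Set X} (hm : memEplus κ m)
    (hA : Concentrated m A) (h0 : m univ ≠ 0) (htop : m univ ≠ ⊤) :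
    (wcap κ A).toReal * (m univ).toReal ^ 2 ≤ realEnergy κ m m := by
  have := hm.regular
  have hb := memBreve_normalize hκ hm hA h0 htop
  have hle := ENNReal.toReal_mono hb.1.2.ne (wcap_le_energy hb)
  rw [energy_smul hκ _ (by simpa using h0), ENNReal.toReal_mul, ENNReal.toReal_mul,
    ENNReal.toReal_inv] at hle
  have hpos := ENNReal.toReal_pos h0 htop
  have h2 := mul_le_mul_of_nonneg_right hle (sq_nonneg (m univ).toReal)
  refine h2.trans_eq ?_
  rw [energy, ← realEnergy]
  field_simp

lemma mutualEnergy_toReal_eq (hκ : IsKernel κ) {μ ν : Measure X} (hμ : memEplus κ μ)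
    (hν : memEplus κ ν) : realEnergy κ μ ν = (∫⁻ x, potential κ μ x ∂ν).toReal := by
  have := hμ.regular
  have := hν.regular
  rw [realEnergy, mutualEnergy_comm hκ, mutualEnergy_eq_lintegral_potential hκ]

lemma lintegral_potential_ne_top (hκ : IsKernel κ) (hE : EnergyPrinciple κ) {μ ν : Measure X}
    (hμ : memEplus κ μ) (hν : memEplus κ ν) : ∫⁻ x, potential κ μ x ∂ν ≠ ⊤ := by
  have := hμ.regular
  have := hν.regular
  rw [← mutualEnergy_eq_lintegral_potential hκ]
  exact mutualEnergy_ne_top hE hν hμ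

lemma ae_wcap_le_potential (hκ : IsKernel κ) (hE : EnergyPrinciple κ) {A : Set X}
    {l : Measure X} (hl : memEplus κ l) (hw : wcap κ A ≠ ⊤)
    (h : ∀ ν, memBreve κ A ν → (wcap κ A).toReal ≤ realEnergy κ l ν) {ν : Measure X}
    (hν : memEplus κ ν) (hA : Concentrated ν A) : ∀ᵐ x ∂ν, wcap κ A ≤ potential κ l x := by
  have := hl.regular
  refine ae_le_of_forall_lintegral_le hκ (measurable_potential hκ l) measurable_const
    (fun σ hσ => ?_) hν hA
  rw [lintegral_const, hσ.2.2, mul_one]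
  refine ⟨?_, hw⟩
  rw [← ENNReal.toReal_le_toReal hw (lintegral_potential_ne_top hκ hE hl hσ.1),
    ← mutualEnergy_toReal_eq hκ hl hσ.1]
  exact h σ hσ

variable [LocallyCompactSpace X]

lemma wcap_mul_one_add_sq_le (hκ : IsKernel κ) (hE : EnergyPrinciple κ) {A : Set X}
    {μ ν : Measure X} (hμ : memBreve κ A μ) (hν : memBreve κ A ν) {t : ℝ} (ht : 0 ≤ t) :
    (wcap κ A).toReal * (1 + t) ^ 2 ≤
      realEnergy κ μ μ + 2 * t * realEnergy κ μ ν + t ^ 2 * realEnergy κ ν ν := by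
  have htop : ENNReal.ofReal t ≠ ⊤ := ENNReal.ofReal_ne_top
  have hmass : (μ + ENNReal.ofReal t • ν) univ = 1 + ENNReal.ofReal t := by
    simp [hμ.2.2, hν.2.2]
  have h := wcap_mul_sq_le hκ (hμ.1.add hκ hE (hν.1.smul hκ htop))
    (hμ.2.1.add (hν.2.1.smul (ENNReal.ofReal t))) (by simp [hmass]) (by simp [hmass])
  rw [hmass, ENNReal.toReal_add (by simp) htop, ENNReal.toReal_ofReal ht,
    realEnergy_add_smul_self hκ hE hμ.1 hν.1 htop, ENNReal.toReal_ofReal ht] at h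
  simpa using h

lemma StrongTendstoSeq.tendsto_realEnergy (hκ : IsKernel κ) (hE : EnergyPrinciple κ)
    {μ : ℕ → Measure X} {μ₀ ν : Measure X} (h : StrongTendstoSeq κ μ μ₀)
    (hμ : ∀ n, memEplus κ (μ n)) (hμ₀ : memEplus κ μ₀) (hν : memEplus κ ν) :
    Tendsto (fun n => realEnergy κ (μ n) ν) atTop (𝓝 (realEnergy κ μ₀ ν)) := by
  rw [tendsto_iff_norm_sub_tendsto_zero]
  refine squeeze_zero (fun n => norm_nonneg _) (fun n => ?_)
    (by simpa using h.mul_const √(realEnergy κ ν ν))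
  rw [Real.norm_eq_abs, strongDist, ← Real.sqrt_mul']
  · exact Real.abs_le_sqrt (sq_realEnergy_sub_le hκ hE (hμ n) hμ₀ hν)
  · exact realEnergy_nonneg _ _ _

lemma StrongTendstoSeq.tendsto_realEnergy_self (hκ : IsKernel κ) (hE : EnergyPrinciple κ)
    {μ : ℕ → Measure X} {μ₀ : Measure X} (h : StrongTendstoSeq κ μ μ₀)
    (hμ : ∀ n, memEplus κ (μ n)) (hμ₀ : memEplus κ μ₀) :
    Tendsto (fun n => realEnergy κ (μ n) (μ n)) atTop (𝓝 (realEnergy κ μ₀ μ₀)) := by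
  have h1 := h.tendsto_realEnergy hκ hE hμ hμ₀ hμ₀
  have h2 := (((h.pow 2).add (h1.const_mul 2)).sub_const (realEnergy κ μ₀ μ₀))
  convert h2 using 2 with n
  · have h3 := two_mul_realEnergy_le hE (hμ n) hμ₀
    rw [strongDist, Real.sq_sqrt]
    · simp only [realEnergy, energy]
      ring
    · simp only [realEnergy] at h3
      simp only [energy]
      linarith
  · ring

/-- Minimizing sequences for `w(A)` converge strongly to a measure of energy `w(A)` whose
potential is at least `w(A)` on average over any unit measure on `A`. -/
lemma exists_strong_limit_of_minimizing (hκ : IsKernel κ) (hP : IsPerfect κ) {A : Set X}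
    {μ : ℕ → Measure X} (hμ : ∀ n, memBreve κ A (μ n))
    (hmin : Tendsto (fun n => realEnergy κ (μ n) (μ n)) atTop (𝓝 (wcap κ A).toReal)) :
    ∃ l, memEplus κ l ∧ StrongTendstoSeq κ μ l ∧ realEnergy κ l l = (wcap κ A).toReal ∧
      ∀ ν, memBreve κ A ν → (wcap κ A).toReal ≤ realEnergy κ l ν := by
  have hE := hP.1
  have hcauchy : StrongCauchySeq κ μ := by
    intro ε hε
    have hev : ∀ᶠ n in atTop, realEnergy κ (μ n) (μ n) < (wcap κ A).toReal + ε ^ 2 / 4 :=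
      hmin.eventually_lt_const (by linarith [pow_pos hε 2])
    obtain ⟨N, hN⟩ := eventually_atTop.1 hev
    refine ⟨N, fun m hm n hn => ?_⟩
    have h1 := wcap_mul_one_add_sq_le hκ hE (hμ m) (hμ n) zero_le_one
    have h2 := hN m hm
    have h3 := hN n hn
    rw [strongDist, Real.sqrt_lt' hε]
    simp only [realEnergy] at h1 h2 h3
    simp only [energy]
    linarith
  obtain ⟨l, hl, hlim⟩ := hP.2.1 μ (fun n => (hμ n).1) hcauchy
  have hll := tendsto_nhds_unique
    (hlim.tendsto_realEnergy_self hκ hE (fun n => (hμ n).1) hl) hmin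
  refine ⟨l, hl, hlim, hll, fun ν hν => ?_⟩
  have hquad : ∀ t : ℝ, 0 ≤ t → (wcap κ A).toReal * (1 + t) ^ 2 ≤
      (wcap κ A).toReal + 2 * t * realEnergy κ l ν + t ^ 2 * realEnergy κ ν ν := by
    intro t ht
    refine ge_of_tendsto' ((hmin.add ((hlim.tendsto_realEnergy hκ hE
      (fun n => (hμ n).1) hl hν.1).const_mul (2 * t))).add_const _) fun n => ?_
    exact wcap_mul_one_add_sq_le hκ hE (hμ n) hν ht
  by_contra! hlt
  set d := (wcap κ A).toReal - realEnergy κ l ν with hd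
  have hdpos : 0 < d := by linarith
  have hN := realEnergy_nonneg κ ν ν
  have hw : 0 ≤ (wcap κ A).toReal := ENNReal.toReal_nonneg
  have ht : 0 < d / (realEnergy κ ν ν + 1) := by positivity
  have h := hquad _ ht.le
  have hmul : d / (realEnergy κ ν ν + 1) * (realEnergy κ ν ν + 1) = d :=
    div_mul_cancel₀ _ (by positivity)
  set t := d / (realEnergy κ ν ν + 1)
  have : t * (2 * d - t * (realEnergy κ ν ν - (wcap κ A).toReal)) ≤ 0 := by
    rw [hd]; nlinarith
  nlinarith [mul_nonneg ht.le hw, mul_pos ht hdpos]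

lemma concentrated_of_vagueTendsto {K : Set X} (hK : IsCompact K) {μ : ℕ → Measure X}
    {l : Measure X} [l.Regular] (hμ : ∀ n, Concentrated (μ n) K) (h : VagueTendstoSeq μ l) :
    Concentrated l K := by
  intro C hC
  by_contra hne
  obtain ⟨D, hDs, hD, hpos⟩ := (hK.measurableSet.compl.inter hC.measurableSet).exists_lt_isCompact
    (pos_iff_ne_zero.2 hne)
  obtain ⟨φ, hφ1, hφ0, hφc, hφ⟩ := exists_continuous_one_zero_of_isCompact hD hK.isClosed
    (disjoint_left.2 fun x hx => (hDs hx).1)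
  have hlim := h φ φ.continuous hφc
  have hzero : ∀ n, ∫ x, φ x ∂(μ n) = 0 := fun n =>
    integral_eq_zero_of_ae ((hμ n).ae_mem.mono fun x hx => hφ0 hx)
  simp only [hzero] at hlim
  have hint := tendsto_nhds_unique hlim tendsto_const_nhds
  rw [integral_eq_zero_iff_of_nonneg (fun x => (hφ x).1)
    (φ.continuous.integrable_of_hasCompactSupport hφc)] at hint
  have hnull : l {x | ¬ φ x = 0} = 0 := hint
  exact hpos.ne' (measure_mono_null (fun x hx => by simp [hφ1 hx]) hnull)

lemma measure_univ_eq_one_of_vagueTendsto {K : Set X} (hK : IsCompact K) {μ : ℕ → Measure X}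
    {l : Measure X} [l.Regular] (hμ : ∀ n, Concentrated (μ n) K) (hμ1 : ∀ n, μ n univ = 1)
    (h : VagueTendstoSeq μ l) : l univ = 1 := by
  obtain ⟨φ, hφ1, -, hφc, -⟩ := exists_continuous_one_zero_of_isCompact hK isClosed_empty
    (disjoint_empty K)
  have hconst : ∀ m : Measure X, Concentrated m K → ∫ x, φ x ∂m = (m univ).toReal := by
    intro m hm
    rw [integral_congr_ae (g := fun _ => (1 : ℝ)) (hm.ae_mem.mono fun x hx => hφ1 hx)]
    simp [Measure.real]
  have hlim := h φ φ.continuous hφc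
  rw [hconst l (concentrated_of_vagueTendsto hK hμ h)] at hlim
  simp only [fun n => hconst (μ n) (hμ n), hμ1, ENNReal.toReal_one] at hlim
  have := tendsto_nhds_unique tendsto_const_nhds hlim
  exact (ENNReal.toReal_eq_one_iff _).1 this.symm

/-- The equilibrium measure of a compact set of positive capacity. -/
lemma exists_compact_equilibrium (hκ : IsKernel κ) (hP : IsPerfect κ) (hF : FrostmanMax κ)
    {K : Set X} (hK : IsCompact K) (hw : wcap κ K ≠ ⊤) :
    ∃ l, memBreve κ K l ∧ realEnergy κ l l = (wcap κ K).toReal ∧ wcap κ K ≠ 0 ∧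
      (∀ ν, memBreve κ K ν → (wcap κ K).toReal ≤ realEnergy κ l ν) ∧
      ∀ x, potential κ l x ≤ wcap κ K := by
  have hE := hP.1
  obtain ⟨μ, hμ, hmin⟩ := exists_minimizing_seq hw
  obtain ⟨l, hl, hlim, hll, hge⟩ := exists_strong_limit_of_minimizing hκ hP hμ hmin
  have := hl.regular
  have hvague := hP.2.2 μ l (fun n => (hμ n).1) hl hlim
  have hlK := concentrated_of_vagueTendsto hK (fun n => (hμ n).2.1) hvague
  have hl1 := measure_univ_eq_one_of_vagueTendsto hK (fun n => (hμ n).2.1)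
    (fun n => (hμ n).2.2) hvague
  have hb : memBreve κ K l := ⟨hl, hlK, hl1⟩
  have hw0 : wcap κ K ≠ 0 := fun h0 => by
    have := realEnergy_pos hE hl hb.ne_zero
    simp [hll, h0] at this
  refine ⟨l, hb, hll, hw0, hge, ?_⟩
  have hae : (fun _ => wcap κ K) =ᵐ[l] potential κ l := by
    refine ae_eq_of_ae_le_of_lintegral_le (ae_wcap_le_potential hκ hE hl hw hge hl hlK) ?_
      (measurable_potential hκ l).aemeasurable ?_
    · simpa [hl1] using hw
    · rw [← ENNReal.toReal_le_toReal (lintegral_potential_ne_top hκ hE hl hl) (by simpa [hl1]),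
        ← mutualEnergy_toReal_eq hκ hl hl, hll]
      simp [hl1]
  have hinv : (wcap κ K)⁻¹ ≠ ⊤ := by simpa using hw0
  have hF' := hF ((wcap κ K)⁻¹ • l) (hl.smul hκ hinv) fun x hx => by
    by_contra! hgt
    rw [potential_smul, ← ENNReal.inv_mul_cancel hw0 hw,
      ENNReal.mul_lt_mul_iff_right (by simpa using hw) hinv] at hgt
    have hpos := hx _ ((potential_lsc hκ l).isOpen_preimage (wcap κ K)) hgt
    rw [Measure.smul_apply, measure_mono_null (fun y hy heq => ?_) hae] at hpos
    · simp at hpos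
    · exact (mem_Ioi.1 hy).ne heq
  intro x
  have h := hF' x
  rwa [potential_smul, ← ENNReal.inv_mul_cancel hw0 hw,
    ENNReal.mul_le_mul_iff_right (by simpa using hw) hinv] at h

/-- The principle of positivity of mass. -/
lemma measure_univ_le_of_potential_le (hκ : IsKernel κ) (hP : IsPerfect κ) (hF : FrostmanMax κ)
    {μ ν : Measure X} (hμ : memEplus κ μ) (hν : memEplus κ ν)
    (h : ∀ x, potential κ μ x ≤ potential κ ν x) : μ univ ≤ ν univ := by
  have := hμ.regular
  have := hν.regular
  rw [isOpen_univ.measure_eq_iSup_isCompact]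
  refine iSup₂_le fun K _ => iSup_le fun hK => ?_
  rcases eq_or_ne (μ K) 0 with h0 | h0
  · simp [h0]
  have hfin : μ K ≠ ⊤ := hK.measure_lt_top.ne
  have hconc := concentrated_restrict (μ := μ) hK.measurableSet
  have hw : wcap κ K ≠ ⊤ := (memBreve_normalize hκ (hμ.restrict hfin) hconc
    (by simpa using h0) (by simpa using hfin)).wcap_ne_top
  obtain ⟨l, hl, -, hw0, hge, hle⟩ := exists_compact_equilibrium hκ hP hF hK hw
  have := hl.1.regular
  have hswap : ∀ σ : Measure X, σ.Regular →
      ∫⁻ x, potential κ l x ∂σ = ∫⁻ x, potential κ σ x ∂l := fun σ _ => by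
    rw [← mutualEnergy_eq_lintegral_potential hκ, mutualEnergy_comm hκ,
      mutualEnergy_eq_lintegral_potential hκ]
  rw [← ENNReal.mul_le_mul_iff_right hw0 hw]
  calc wcap κ K * μ K = ∫⁻ _, wcap κ K ∂(μ.restrict K) := by simp
    _ ≤ ∫⁻ x, potential κ l x ∂(μ.restrict K) :=
      lintegral_mono_ae (ae_wcap_le_potential hκ hP.1 hl.1 hw hge (hμ.restrict hfin) hconc)
    _ ≤ ∫⁻ x, potential κ l x ∂μ := setLIntegral_le_lintegral _ _
    _ = ∫⁻ x, potential κ μ x ∂l := hswap μ inferInstance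
    _ ≤ ∫⁻ x, potential κ ν x ∂l := lintegral_mono h
    _ = ∫⁻ x, potential κ l x ∂ν := (hswap ν inferInstance).symm
    _ ≤ ∫⁻ _, wcap κ K ∂ν := lintegral_mono hle
    _ = wcap κ K * ν univ := by simp

end Minimizers

section Equilibrium

variable {X : Type*} [TopologicalSpace X] [T2Space X] [SigmaCompactSpace X] [MeasurableSpace X]
  [BorelSpace X] {κ : X → X → ℝ≥0∞}

/-- `w(A)` can be approximated by `w(K)` for compact `K ⊆ A`. -/
lemma exists_isCompact_wcap_lt (hκ : IsKernel κ) {A : Set X} (hw : wcap κ A ≠ ⊤) {ε : ℝ}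
    (hε : 0 < ε) : ∃ K ⊆ A, IsCompact K ∧ wcap κ K ≠ ⊤ ∧
      (wcap κ K).toReal < (wcap κ A).toReal + ε := by
  obtain ⟨ν, hν, hlt⟩ := exists_memBreve_realEnergy_lt (κ := κ) hw hε
  have := hν.1.regular
  set a := (wcap κ A).toReal + ε
  set e := realEnergy κ ν ν with he
  have he0 : 0 ≤ e := realEnergy_nonneg κ ν ν
  have ha : 0 < a := he0.trans_lt hlt
  have hnull : ν (toMeasurable ν Aᶜ) = 0 := by
    rw [measure_toMeasurable]
    exact hν.2.1.ae_mem
  have hone : ν (toMeasurable ν Aᶜ)ᶜ = 1 := by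
    rw [← hν.2.2]
    exact measure_of_measure_compl_eq_zero (by rwa [compl_compl])
  have hr : ENNReal.ofReal √(e / a) < ν (toMeasurable ν Aᶜ)ᶜ := by
    rw [hone, ENNReal.ofReal_lt_one, Real.sqrt_lt' one_pos, one_pow, div_lt_one ha]
    exact hlt
  obtain ⟨K, hKs, hK, hrK⟩ := (measurableSet_toMeasurable ν Aᶜ).compl.exists_lt_isCompact hr
  have h0 : ν K ≠ 0 := (zero_le.trans_lt hrK).ne'
  have hfin : ν K ≠ ⊤ := hK.measure_lt_top.ne
  have hconc := concentrated_restrict (μ := ν) hK.measurableSet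
  have hKA : K ⊆ A := fun x hx => by
    by_contra hxA
    exact hKs hx (subset_toMeasurable ν Aᶜ hxA)
  have hres := hν.1.restrict hfin
  refine ⟨K, hKA, hK, (memBreve_normalize hκ hres hconc (by simpa using h0)
    (by simpa using hfin)).wcap_ne_top, ?_⟩
  have h1 := wcap_mul_sq_le hκ hres hconc (by simpa using h0) (by simpa using hfin)
  have h2 : realEnergy κ (ν.restrict K) (ν.restrict K) ≤ e := by
    refine ENNReal.toReal_mono hν.1.2.ne ?_
    rw [mutualEnergy, mutualEnergy, Measure.prod_restrict]
    exact setLIntegral_le_lintegral _ _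
  rw [Measure.restrict_apply_univ] at h1
  have h3 : e / a < (ν K).toReal ^ 2 := by
    rw [← Real.sqrt_lt (by positivity) ENNReal.toReal_nonneg]
    exact (ENNReal.ofReal_lt_iff_lt_toReal (Real.sqrt_nonneg _) hfin).1 hrK
  rw [div_lt_iff₀ ha] at h3
  have hpos : 0 < (ν K).toReal ^ 2 := pow_pos (ENNReal.toReal_pos h0 hfin) 2
  nlinarith

variable [LocallyCompactSpace X]

/-- The equilibrium measure of a set `A` of finite positive capacity with `E⁺(A)` closed. -/
lemma exists_equilibrium (hκ : IsKernel κ) (hP : IsPerfect κ) (hF : FrostmanMax κ) {A : Set X}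
    (hA : StrongClosedEplusOn κ A) (hw : wcap κ A ≠ ⊤) (hw0 : wcap κ A ≠ 0) :
    ∃ l, memBreve κ A l ∧ ∀ ν, memBreve κ A ν → realEnergy κ l ν = (wcap κ A).toReal := by
  have hE := hP.1
  choose K hKA hK hKw hKlt using fun n : ℕ =>
    exists_isCompact_wcap_lt hκ hw (Nat.one_div_pos_of_nat : 0 < 1 / ((n : ℝ) + 1))
  choose μ hμ hμe _ _ hμle using fun n =>
    exists_compact_equilibrium hκ hP hF (hK n) (hKw n)
  have hlimu : Tendsto (fun n : ℕ => (wcap κ A).toReal + 1 / ((n : ℝ) + 1)) atTop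
      (𝓝 ((wcap κ A).toReal + 0)) := tendsto_one_div_add_atTop_nhds_zero_nat.const_add _
  rw [add_zero] at hlimu
  have hμA : ∀ n, memBreve κ A (μ n) := fun n => (hμ n).mono (hKA n)
  have hKlim : Tendsto (fun n => (wcap κ (K n)).toReal) atTop (𝓝 (wcap κ A).toReal) := by
    refine tendsto_of_tendsto_of_tendsto_of_le_of_le tendsto_const_nhds hlimu
      (fun n => ?_) fun n => (hKlt n).le
    refine (ENNReal.toReal_mono (hμA n).1.2.ne (wcap_le_energy (hμA n))).trans_eq ?_
    exact hμe n
  obtain ⟨l, hl, hlim, hll, hge⟩ := exists_strong_limit_of_minimizing hκ hP hμA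
    (by simpa only [hμe] using hKlim)
  have hlA : Concentrated l A := hA μ l (fun n => ⟨(hμA n).1, (hμA n).2.1⟩) hl hlim
  have heq : ∀ ν, memBreve κ A ν → realEnergy κ l ν = (wcap κ A).toReal := fun ν hν => by
    refine le_antisymm (le_of_tendsto_of_tendsto'
      (hlim.tendsto_realEnergy hκ hE (fun n => (hμA n).1) hl hν.1) hKlim fun n => ?_) (hge ν hν)
    rw [mutualEnergy_toReal_eq hκ (hμ n).1 hν.1]
    refine ENNReal.toReal_mono (hKw n) ((lintegral_mono (hμle n)).trans_eq ?_)
    simp [hν.2.2]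
  have hwpos := ENNReal.toReal_pos hw0 hw
  have := hl.regular
  have hmass : l univ ≤ 1 := by
    rw [isOpen_univ.measure_eq_iSup_isCompact]
    refine iSup₂_le fun C _ => iSup_le fun hC => ?_
    rcases eq_or_ne (l C) 0 with h0 | h0
    · simp [h0]
    have hfin : l C ≠ ⊤ := hC.measure_lt_top.ne
    have hb := (memBreve_normalized_restrict hκ hl hlA hC h0).mono inter_subset_left
    have h1 := heq _ hb
    rw [realEnergy_comm hκ hl hb.1, realEnergy_smul_left hκ _ (by simpa using h0)
      (hl.restrict hfin) hl, ENNReal.toReal_inv, realEnergy_comm hκ (hl.restrict hfin) hl] at h1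
    have h2 : realEnergy κ l (l.restrict C) ≤ realEnergy κ l l := by
      rw [mutualEnergy_toReal_eq hκ hl hl, mutualEnergy_toReal_eq hκ hl (hl.restrict hfin)]
      exact ENNReal.toReal_mono (lintegral_potential_ne_top hκ hE hl hl)
        (setLIntegral_le_lintegral _ _)
    have hpos := ENNReal.toReal_pos h0 hfin
    rw [inv_mul_eq_iff_eq_mul₀ hpos.ne'] at h1
    rw [h1, hll] at h2
    rw [← ENNReal.toReal_le_toReal hfin (by simp), ENNReal.toReal_one]
    nlinarith
  have hl0 : l univ ≠ 0 := fun h0 => by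
    rw [Measure.measure_univ_eq_zero] at h0
    simp [h0, realEnergy, mutualEnergy] at hll
    exact hwpos.ne hll
  have htop : l univ ≠ ⊤ := (hmass.trans_lt ENNReal.one_lt_top).ne
  have hb := memBreve_normalize hκ hl hlA hl0 htop
  have h1 := heq _ hb
  rw [realEnergy_comm hκ hl hb.1, realEnergy_smul_left hκ _ (by simpa using hl0) hl hl, hll,
    mul_eq_right₀ hwpos.ne', ENNReal.toReal_inv, inv_eq_one,
    ENNReal.toReal_eq_one_iff] at h1
  exact ⟨l, ⟨hl, hlA, h1⟩, heq⟩

end Equilibrium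

section Gauss

lemma coe_le_wPotential_iff {X : Type*} [MeasurableSpace X]
    {κ : X → X → ℝ≥0∞} {f : X → EReal} {ζ μ : Measure X} {x : X} {c : ℝ≥0∞}
    (hf : f x = -(potential κ ζ x : EReal)) :
    (c : EReal) ≤ wPotential κ f μ x ↔
      potential κ ζ x ≠ ⊤ ∧ c + potential κ ζ x ≤ potential κ μ x := by
  rw [wPotential, hf, ← sub_eq_add_neg]
  rcases eq_or_ne (potential κ ζ x) ⊤ with h | h
  · simp [h, EReal.sub_top]
  · rw [EReal.le_sub_iff_add_le (by simp) (by simp [h]), ← EReal.coe_ennreal_add,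
      EReal.coe_ennreal_le_coe_ennreal_iff]
    simp [h]

lemma toReal_field_eq {X : Type*} [MeasurableSpace X] {κ : X → X → ℝ≥0∞} {f : X → EReal}
    {ζ : Measure X} (hf : ∀ x, f x = -(potential κ ζ x : EReal)) :
    (fun x => (f x).toReal) = fun x => -(potential κ ζ x).toReal := by
  funext x
  simp [hf, EReal.toReal_neg_eq]

variable {X : Type*} [TopologicalSpace X] [T2Space X] [SigmaCompactSpace X] [MeasurableSpace X]
  [BorelSpace X] {κ : X → X → ℝ≥0∞} {f : X → EReal} {ζ : Measure X}

lemma measurableSet_le_wPotential (hκ : IsKernel κ) [ζ.Regular]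
    (hf : ∀ x, f x = -(potential κ ζ x : EReal)) (c : ℝ≥0∞)
    (μ : Measure X) [μ.Regular] : MeasurableSet {x | (c : EReal) ≤ wPotential κ f μ x} := by
  have hset : {x | (c : EReal) ≤ wPotential κ f μ x} =
      {x | potential κ ζ x ≠ ⊤ ∧ c + potential κ ζ x ≤ potential κ μ x} :=
    Set.ext fun x => coe_le_wPotential_iff (hf x)
  rw [hset]
  have hζ := measurable_potential hκ ζ
  exact (hζ (measurableSet_singleton ⊤).compl).inter
    (measurableSet_le (hζ.const_add c) (measurable_potential hκ μ))

lemma fieldIntegral_eq (hκ : IsKernel κ) (hE : EnergyPrinciple κ) (hζ : memEplus κ ζ)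
    (hf : ∀ x, f x = -(potential κ ζ x : EReal)) {μ : Measure X} (hμ : memEplus κ μ) :
    fieldIntegral f μ = -realEnergy κ ζ μ := by
  have := hζ.regular
  have hmeas := measurable_potential hκ ζ
  have hfin := lintegral_potential_ne_top hκ hE hζ hμ
  rw [fieldIntegral, toReal_field_eq hf, integral_neg, integral_toReal hmeas.aemeasurable (ae_lt_top hmeas hfin),
    mutualEnergy_toReal_eq hκ hζ hμ]

lemma fieldIntegrable (hκ : IsKernel κ) (hE : EnergyPrinciple κ) (hζ : memEplus κ ζ)
    (hf : ∀ x, f x = -(potential κ ζ x : EReal)) {μ : Measure X} (hμ : memEplus κ μ) :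
    FieldIntegrable f μ := by
  have := hζ.regular
  have hmeas := measurable_potential hκ ζ
  have hfin := lintegral_potential_ne_top hκ hE hζ hμ
  refine ⟨?_, (ae_lt_top hmeas hfin).mono fun x hx => ?_⟩
  · rw [toReal_field_eq hf]
    exact (integrable_toReal_of_lintegral_ne_top hmeas.aemeasurable hfin).neg
  · simp [hf, hx.ne]

/-- A unit measure on `A` whose potential exceeds `U^ζ` by a constant, on average over every
unit measure on `A`, is the only possible solution of the Gauss problem. -/
lemma IsSolution.eq_of_realEnergy_eq (hκ : IsKernel κ) (hE : EnergyPrinciple κ)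
    (hζ : memEplus κ ζ) (hf : ∀ x, f x = -(potential κ ζ x : EReal)) {A : Set X}
    {l m : Measure X} (hl : IsSolution κ A f l) (hm : memBreve κ A m) {c : ℝ}
    (h : ∀ ν, memBreve κ A ν → realEnergy κ m ν = realEnergy κ ζ ν + c) : l = m := by
  have hle : gaussI κ f l ≤ gaussI κ f m := by
    rw [← EReal.coe_le_coe_iff, hl.2]
    exact iInf₂_le m ⟨hm, fieldIntegrable hκ hE hζ hf hm.1⟩
  have hl1 := hl.1.1
  rw [gaussI, gaussI, fieldIntegral_eq hκ hE hζ hf hl1.1, fieldIntegral_eq hκ hE hζ hf hm.1,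
    energy, energy, ← realEnergy, ← realEnergy] at hle
  have h1 := h l hl1
  have h2 := h m hm
  rw [realEnergy_comm hκ hm.1 hl1.1] at h1
  exact eq_of_realEnergy_le hE hl1.1 hm.1 (by linarith)

/-- `U^β = U^ζ` almost everywhere for every finite-energy measure on `A`. -/
lemma IsInnerBalayage.ae_potential_eq (hκ : IsKernel κ) {A : Set X} {β ν : Measure X}
    (hζ : memEplus κ ζ) (hβ : IsInnerBalayage κ A ζ β) (hν : memEplus κ ν)
    (hA : Concentrated ν A) : potential κ β =ᵐ[ν] potential κ ζ := by
  have := hζ.regular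
  have := hβ.1.regular
  exact (nearlyEverywhere_iff hκ (measurableSet_eq_fun (measurable_potential hκ β)
    (measurable_potential hκ ζ))).1 hβ.2.2 ν hν hA

lemma ae_potential_eq_add_const (hκ : IsKernel κ) (hE : EnergyPrinciple κ) (hζ : memEplus κ ζ)
    {A : Set X} {m : Measure X} (hm : memEplus κ m) {c : ℝ≥0∞} (hc : c ≠ ⊤)
    (h : ∀ ν, memBreve κ A ν → realEnergy κ m ν = realEnergy κ ζ ν + c.toReal)
    {ν : Measure X} (hν : memEplus κ ν) (hA : Concentrated ν A) :
    ∀ᵐ x ∂ν, potential κ m x = c + potential κ ζ x := by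
  have := hζ.regular
  have := hm.regular
  have hζm := measurable_potential hκ ζ
  have hint : ∀ σ, memBreve κ A σ →
      ∫⁻ x, potential κ m x ∂σ = ∫⁻ x, c + potential κ ζ x ∂σ := fun σ hσ => by
    have h1 := lintegral_potential_ne_top hκ hE hm hσ.1
    have h2 := lintegral_potential_ne_top hκ hE hζ hσ.1
    rw [lintegral_add_left measurable_const, lintegral_const, hσ.2.2, mul_one,
      ← ENNReal.toReal_eq_toReal_iff' h1 (ENNReal.add_ne_top.2 ⟨hc, h2⟩),
      ENNReal.toReal_add hc h2, ← mutualEnergy_toReal_eq hκ hm hσ.1,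
      ← mutualEnergy_toReal_eq hκ hζ hσ.1, h σ hσ, add_comm]
  have hfin : ∀ σ, memBreve κ A σ → ∫⁻ x, potential κ m x ∂σ ≠ ⊤ := fun σ hσ =>
    lintegral_potential_ne_top hκ hE hm hσ.1
  filter_upwards [ae_le_of_forall_lintegral_le hκ (measurable_potential hκ m) (hζm.const_add c)
      (fun σ hσ => ⟨(hint σ hσ).ge, hint σ hσ ▸ hfin σ hσ⟩) hν hA,
    ae_le_of_forall_lintegral_le hκ (hζm.const_add c) (measurable_potential hκ m)
      (fun σ hσ => ⟨(hint σ hσ).le, hfin σ hσ⟩) hν hA] with x h1 h2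
  exact le_antisymm h2 h1

variable [LocallyCompactSpace X]

lemma IsInnerBalayage.measure_univ_le (hκ : IsKernel κ) (hP : IsPerfect κ) (hF : FrostmanMax κ)
    (hD : DominationPrinciple κ) {A : Set X} {β : Measure X}
    (hζ : memEplus κ ζ) (hβ : IsInnerBalayage κ A ζ β) : β univ ≤ ζ univ :=
  measure_univ_le_of_potential_le hκ hP hF hβ.1 hζ
    (hD β ζ hβ.1 hζ ((hβ.ae_potential_eq hκ hζ hβ.1 hβ.2.1).mono fun _ hx => hx.le))

/-- The measure `ζ^A + (1 - ζ^A(X)) γ`, with `γ` the equilibrium measure of `A`. -/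
lemma exists_memBreve_realEnergy_eq (hκ : IsKernel κ) (hP : IsPerfect κ) (hF : FrostmanMax κ)
    {A : Set X} {β : Measure X} (hcap : innerCap κ A ≠ 0) (hA : StrongClosedEplusOn κ A)
    (hζ : memEplus κ ζ) (hβ : IsInnerBalayage κ A ζ β) (hβ1 : β univ ≤ 1)
    (hex : innerCap κ A ≠ ⊤ ∨ β univ = 1) :
    ∃ m, memBreve κ A m ∧ ∀ ν, memBreve κ A ν →
      realEnergy κ m ν = realEnergy κ ζ ν + ((1 - β univ) / innerCap κ A).toReal := by
  have hβν : ∀ ν, memBreve κ A ν → realEnergy κ β ν = realEnergy κ ζ ν := fun ν hν => by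
    rw [mutualEnergy_toReal_eq hκ hβ.1 hν.1, mutualEnergy_toReal_eq hκ hζ hν.1,
      lintegral_congr_ae (hβ.ae_potential_eq hκ hζ hν.1 hν.2.1)]
  by_cases h1 : β univ = 1
  · exact ⟨β, ⟨hβ.1, hβ.2.1, h1⟩, fun ν hν => by simp [hβν ν hν, h1]⟩
  obtain ⟨γ, hγ, hγν⟩ := exists_equilibrium hκ hP hF hA
    (by simpa [innerCap] using hcap) (by simpa [innerCap] using hex.resolve_right h1)
  have htop : 1 - β univ ≠ ⊤ := (tsub_le_self.trans_lt ENNReal.one_lt_top).ne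
  refine ⟨β + (1 - β univ) • γ, ⟨hβ.1.add hκ hP.1 (hγ.1.smul hκ htop),
    hβ.2.1.add (hγ.2.1.smul _), by simp [hγ.2.2, hβ1]⟩, fun ν hν => ?_⟩
  rw [realEnergy_add_left hκ hP.1 hβ.1 (hγ.1.smul hκ htop) hν.1,
    realEnergy_smul_left hκ _ htop hγ.1 hν.1, hβν ν hν, hγν ν hν, innerCap, div_eq_mul_inv,
    inv_inv, ENNReal.toReal_mul]

end Gauss

theorem stmt9 {X : Type*} [TopologicalSpace X] [T2Space X] [LocallyCompactSpace X]
    [SigmaCompactSpace X] [MeasurableSpace X] [BorelSpace X]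
    (κ : X → X → ℝ≥0∞) (A : Set X) (ζ β : Measure X) (f : X → EReal)
    (hker : IsKernel κ) (hperf : IsPerfect κ)
    (hfr : FrostmanMax κ) (hdom : DominationPrinciple κ)
    (hcap0 : innerCap κ A ≠ 0) (hclosed : StrongClosedEplusOn κ A)
    (hζ : memEplus κ ζ) (hζ1 : ζ Set.univ ≤ 1)
    (hf : ∀ x, f x = -((potential κ ζ x : ℝ≥0∞) : EReal))
    (hβ : IsInnerBalayage κ A ζ β)
    (hex : innerCap κ A ≠ ⊤ ∨ β Set.univ = 1)
    (l : Measure X) (hl : IsSolution κ A f l) :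
    -- `l ∈ Λ_{A,f}` and `l` has minimum total mass `1` in `Λ_{A,f}`
    (memEplus κ l ∧ NearlyEverywhere κ A
      (fun x => ((((1 : ℝ≥0∞) - β Set.univ) / innerCap κ A : ℝ≥0∞) : EReal)
        ≤ wPotential κ f l x)) ∧
    l Set.univ = 1 ∧
    ∀ μ : Measure X, memEplus κ μ →
      NearlyEverywhere κ A
        (fun x => ((((1 : ℝ≥0∞) - β Set.univ) / innerCap κ A : ℝ≥0∞) : EReal)
          ≤ wPotential κ f μ x) →
      l Set.univ ≤ μ Set.univ := by
  have hE := hperf.1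
  have hβ1 := (hβ.measure_univ_le hker hperf hfr hdom hζ).trans hζ1
  obtain ⟨m, hm, hmν⟩ := exists_memBreve_realEnergy_eq hker hperf hfr hcap0 hclosed hζ hβ hβ1 hex
  obtain rfl := hl.eq_of_realEnergy_eq hker hE hζ hf hm hmν
  have hc : ((1 : ℝ≥0∞) - β Set.univ) / innerCap κ A ≠ ⊤ :=
    ENNReal.div_ne_top (tsub_le_self.trans_lt ENNReal.one_lt_top).ne hcap0
  have := hζ.regular
  have := hm.1.regular
  have hae := fun ν hν hA =>
    ae_potential_eq_add_const (ν := ν) hker hE hζ hm.1 hc hmν hν hA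
  refine ⟨⟨hm.1, (nearlyEverywhere_iff hker (measurableSet_le_wPotential hker hf _ l)).2
    fun ν hν hA => ?_⟩, hm.2.2, fun μ hμ hμΛ => ?_⟩
  · filter_upwards [hae ν hν hA, ae_lt_top (measurable_potential hker ζ)
      (lintegral_potential_ne_top hker hE hζ hν)] with x hx hfin
    exact (coe_le_wPotential_iff (hf x)).2 ⟨hfin.ne, hx.ge⟩
  · have := hμ.regular
    refine measure_univ_le_of_potential_le hker hperf hfr hm.1 hμ (hdom l μ hm.1 hμ ?_)
    filter_upwards [hae l hm.1 hm.2.1, (nearlyEverywhere_iff hker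
      (measurableSet_le_wPotential hker hf _ μ)).1 hμΛ l hm.1 hm.2.1] with x hx hxΛ
    exact hx.trans_le ((coe_le_wPotential_iff (hf x)).1 hxΛ).2

end GaussVar
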